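/- arXiv:1510.06201 — 6 statements merged into one kernel-verified Lean document; each statement's English description precedes it below -/
import Mathlib

section
/- The influence value function σ is submodular: for all finite sets S ⊆ T of vertices and every vertex v, σ(S ∪ {v}) − σ(S) ≥ σ(T ∪ {v}) − σ(T). -/
open Finset

/-- The influence value function σ of the WIC model is submodular:
for finite seed sets S ⊆ T and any vertex v,
σ(S ∪ {v}) − σ(S) ≥ σ(T ∪ {v}) − σ(T). -/
theorem sigma_submodular {V : Type*} [Fintype V] [DecidableEq V]
    (w : V → ℝ) (p : V → V → ℝ)
    (hw : ∀ v, 0 ≤ w v)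
    (hp0 : ∀ u v, 0 ≤ p u v) (hp1 : ∀ u v, p u v ≤ 1)
    (σ : Finset V → ℝ)
    (hσ : ∀ S : Finset V,
      σ S = (∑ u ∈ S, w u) + ∑ v : V, w v * (1 - ∏ u ∈ S, (1 - p u v)))
    (S T : Finset V) (hST : S ⊆ T) (v : V) :
    σ (insert v T) - σ T ≤ σ (insert v S) - σ S := by
  have gain : ∀ A : Finset V, v ∉ A → σ (insert v A) - σ A =
      w v + ∑ x : V, w x * (p v x * ∏ u ∈ A, (1 - p u x)) := by
    intro A hA
    have e : ∑ x : V, w x * (1 - ∏ u ∈ insert v A, (1 - p u x)) =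
        ∑ x : V, w x * (1 - ∏ u ∈ A, (1 - p u x)) +
        ∑ x : V, w x * (p v x * ∏ u ∈ A, (1 - p u x)) := by
      rw [← Finset.sum_add_distrib]
      refine Finset.sum_congr rfl fun x _ => ?_
      rw [Finset.prod_insert hA]
      ring
    rw [hσ, hσ, e, Finset.sum_insert hA]
    ring
  have hq : ∀ u x, 0 ≤ 1 - p u x := fun u x => sub_nonneg.2 (hp1 u x)
  by_cases hT : v ∈ T
  · rw [Finset.insert_eq_of_mem hT, sub_self]
    by_cases hS : v ∈ S
    · rw [Finset.insert_eq_of_mem hS, sub_self]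
    · rw [gain S hS]
      exact add_nonneg (hw v) (Finset.sum_nonneg fun x _ => mul_nonneg (hw x)
        (mul_nonneg (hp0 v x) (Finset.prod_nonneg fun u _ => hq u x)))
  · rw [gain T hT, gain S fun h => hT (hST h)]
    refine add_le_add le_rfl (Finset.sum_le_sum fun x _ => mul_le_mul_of_nonneg_left
      (mul_le_mul_of_nonneg_left ?_ (hp0 v x)) (hw x))
    rw [← Finset.prod_sdiff hST]
    refine mul_le_of_le_one_left (Finset.prod_nonneg fun u _ => hq u x) ?_
    exact Finset.prod_le_one (fun u _ => hq u x) fun u _ => by linarith [hp0 u x]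
end

section
/- Greedy (1 − 1/e)-approximation for monotone submodular maximization: let f : Finset V → ℝ be monotone, submodular and normalized, let k ≥ 1, and let S₀ = ∅, S_{i+1} = insert v_i S_i (0 ≤ i < k) be a greedy chain, i.e. v_i ∉ S_i and f(insert v_i S_i) ≥ f(insert v S_i) for every vertex v. Then for every finite set T of vertices with |T| = k, f(S_k) ≥ (1 − 1/e) · f(T), where e is the base of the natural logarithm. -/
open Finset

/-- Greedy (1 − 1/e)-approximation for monotone submodular maximization. -/
theorem greedy_approx {V : Type*} [Fintype V] [DecidableEq V]
    (f : Finset V → ℝ)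
    (hmono : ∀ S T : Finset V, S ⊆ T → f S ≤ f T)
    (hsub : ∀ S T : Finset V, S ⊆ T → ∀ v : V,
      f (insert v T) - f T ≤ f (insert v S) - f S)
    (hnorm : f ∅ = 0)
    (k : ℕ) (hk : 1 ≤ k)
    (S : ℕ → Finset V) (v : ℕ → V)
    (hS0 : S 0 = ∅)
    (hgreedy : ∀ i < k, v i ∉ S i ∧ S (i + 1) = insert (v i) (S i) ∧
      ∀ u : V, f (insert u (S i)) ≤ f (insert (v i) (S i)))
    (T : Finset V) (hT : T.card = k) :
    (1 - 1 / Real.exp 1) * f T ≤ f (S k) := by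
  have hun : ∀ (A : Finset V) (d : ℝ), (∀ u, f (insert u A) - f A ≤ d) →
      ∀ U : Finset V, f (A ∪ U) - f A ≤ (U.card : ℝ) * d := by
    intro A d hd U
    induction U using Finset.induction_on with
    | empty => simp
    | insert a U ha ih =>
      have h1 := hsub A (A ∪ U) Finset.subset_union_left a
      have h2 := hd a
      rw [Finset.union_insert, Finset.card_insert_of_notMem ha]
      push_cast
      linarith
  have hk0 : (0 : ℝ) < k := by exact_mod_cast hk
  have hk1 : (1 : ℝ) ≤ k := by exact_mod_cast hk
  have hr : (0 : ℝ) ≤ 1 - 1 / k := by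
    rw [sub_nonneg, div_le_one hk0]
    exact hk1
  have hstep : ∀ i < k, f T - f (S (i + 1)) ≤ (1 - 1 / (k : ℝ)) * (f T - f (S i)) := by
    intro i hi
    obtain ⟨_, h2, h3⟩ := hgreedy i hi
    have h := hun (S i) (f (S (i + 1)) - f (S i)) (fun u => by
      have := h3 u
      rw [h2]
      linarith) T
    have hm := hmono T (S i ∪ T) Finset.subset_union_right
    rw [hT] at h
    have h5 : (f T - f (S i)) / k ≤ f (S (i + 1)) - f (S i) := by
      rw [div_le_iff₀ hk0]
      linarith
    have h6 : (1 - 1 / (k : ℝ)) * (f T - f (S i))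
        = (f T - f (S i)) - (f T - f (S i)) / k := by ring
    linarith
  have hind : ∀ i ≤ k, f T - f (S i) ≤ (1 - 1 / (k : ℝ)) ^ i * f T := by
    intro i
    induction i with
    | zero => intro _; simp [hS0, hnorm]
    | succ i ih =>
      intro hi
      have h1 := hstep i (by omega)
      have h2 := mul_le_mul_of_nonneg_left (ih (by omega)) hr
      rw [pow_succ]
      linarith
  have hT0 : 0 ≤ f T := hnorm ▸ hmono ∅ T (Finset.empty_subset T)
  have hexp : (1 - 1 / (k : ℝ)) ^ k ≤ 1 / Real.exp 1 := by
    rw [one_div (Real.exp 1), ← Real.exp_neg]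
    exact Real.one_sub_div_pow_le_exp_neg hk1
  have := hind k le_rfl
  have := mul_le_mul_of_nonneg_right hexp hT0
  linarith
end

section
/- Per-step greedy lemma: let f : Finset V → ℝ be monotone, submodular and normalized, let k ≥ 1, and let T be a finite set of vertices with |T| ≤ k. If S is any finite set of vertices and v* ∉ S satisfies f(insert v* S) ≥ f(insert v S) for every vertex v, then f(insert v* S) − f(S) ≥ (f(T) − f(S)) / k. -/
open Finset

/-- Per-step greedy lemma: a greedily chosen vertex gains at least a 1/k
fraction of the remaining gap to any set of size at most k. -/
theorem greedy_step {V : Type*} [Fintype V] [DecidableEq V]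
    (f : Finset V → ℝ)
    (hmono : ∀ S T : Finset V, S ⊆ T → f S ≤ f T)
    (hsub : ∀ S T : Finset V, S ⊆ T → ∀ v : V,
      f (insert v T) - f T ≤ f (insert v S) - f S)
    (hnorm : f ∅ = 0)
    (k : ℕ) (hk : 1 ≤ k)
    (T : Finset V) (hT : T.card ≤ k)
    (S : Finset V) (vstar : V) (hvS : vstar ∉ S)
    (hbest : ∀ v : V, f (insert v S) ≤ f (insert vstar S)) :
    (f T - f S) / k ≤ f (insert vstar S) - f S := by
  have key : ∀ U : Finset V, f (S ∪ U) - f S ≤ U.card * (f (insert vstar S) - f S) := by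
    intro U
    induction U using Finset.induction_on with
    | empty => simp
    | insert a U ha ih =>
      rw [Finset.card_insert_of_notMem ha, Finset.union_insert]
      push_cast
      have h1 := hsub S (S ∪ U) Finset.subset_union_left a
      have h2 := hbest a
      linarith
  have hk' : (0 : ℝ) < k := by exact_mod_cast hk
  rw [div_le_iff₀ hk']
  have h1 := hmono T (S ∪ T) Finset.subset_union_right
  have h2 := key T
  have h3 := hmono S (insert vstar S) (Finset.subset_insert _ _)
  have h4 : (T.card : ℝ) ≤ k := by exact_mod_cast hT
  have h5 := mul_le_mul_of_nonneg_right h4 (sub_nonneg.2 h3)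
  linarith
end

section
/- FPTAS threshold inequality, case p·d ≤ 1: let p, d be real numbers with 0 < p < 1, 1 < d and p·d ≤ 1, let ε ≥ 0, let α be a natural number, and assume 0 < 1 − (1 − (p·d)^α)/((1 − 1/e)(1 + ε)). Let θ be a real number with 0 < θ < 1 and θ ≤ (1 − (1 − (p·d)^α)/((1 − 1/e)(1 + ε)))^{1/(1 + 1/log_d p)}, and set α' = log_p θ. Then (1 − (p·d)^α)/((1 − 1/e)(1 + ε)) ≤ 1 − (p·d)^{α'}, where powers are real powers and e is the base of the natural logarithm. -/
open Real

/-- FPTAS threshold inequality, case p·d ≤ 1. -/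
theorem fptas_threshold_le_one (p d : ℝ)
    (hp0 : 0 < p) (hp1 : p < 1) (hd : 1 < d) (hpd : p * d ≤ 1)
    (ε : ℝ) (hε : 0 ≤ ε) (α : ℕ)
    (hpos : 0 < 1 - (1 - (p * d) ^ (α : ℝ)) / ((1 - 1 / Real.exp 1) * (1 + ε)))
    (θ : ℝ) (hθ0 : 0 < θ) (hθ1 : θ < 1)
    (hθ : θ ≤ (1 - (1 - (p * d) ^ (α : ℝ)) / ((1 - 1 / Real.exp 1) * (1 + ε)))
            ^ (1 / (1 + 1 / Real.logb d p))) :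
    (1 - (p * d) ^ (α : ℝ)) / ((1 - 1 / Real.exp 1) * (1 + ε))
      ≤ 1 - (p * d) ^ (Real.logb p θ) := by
  rcases hpd.eq_or_lt with h1 | h1
  · simp [h1]
  have hpd0 : 0 < p * d := by positivity
  have hlp : Real.log p < 0 := Real.log_neg hp0 hp1
  have hld : 0 < Real.log d := Real.log_pos hd
  have hlpd : Real.log (p * d) < 0 := Real.log_neg hpd0 h1
  have hc : 1 + 1 / Real.logb d p = Real.log (p * d) / Real.log p := by
    rw [Real.log_mul hp0.ne' (by positivity), Real.logb, one_div_div, add_div,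
      div_self hlp.ne]
  have hcpos : 0 < Real.log (p * d) / Real.log p := div_pos_of_neg_of_neg hlpd hlp
  rw [hc] at hθ
  have key : (p * d) ^ (Real.logb p θ) = θ ^ (Real.log (p * d) / Real.log p) := by
    rw [Real.rpow_def_of_pos hpd0, Real.rpow_def_of_pos hθ0, Real.logb]
    congr 1
    ring
  have h := Real.rpow_le_rpow hθ0.le hθ hcpos.le
  rw [← Real.rpow_mul hpos.le, one_div_mul_cancel hcpos.ne', Real.rpow_one] at h
  rw [key]
  linarith
end

section
/- FPTAS threshold inequality, case p·d > 1: let p, d be real numbers with 0 < p < 1, 1 < d and p·d > 1, let ε ≥ 0, and let α ≥ 1 be a natural number. Let θ be a real number with 0 < θ < 1 and θ ≤ (1 − (1 − (p·d)^α)/((1 − 1/e)(1 + ε)))^{1/(1 + 1/log_d p)}, and set α' = log_p θ. Then (1 − (p·d)^α)/((1 − 1/e)(1 + ε)) ≥ 1 − (p·d)^{α'}, where powers are real powers and e is the base of the natural logarithm. -/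
open Real

/-- FPTAS threshold inequality, case p·d > 1. -/
theorem fptas_threshold_gt_one (p d : ℝ)
    (hp0 : 0 < p) (hp1 : p < 1) (hd : 1 < d) (hpd : 1 < p * d)
    (ε : ℝ) (hε : 0 ≤ ε) (α : ℕ) (hα : 1 ≤ α)
    (θ : ℝ) (hθ0 : 0 < θ) (hθ1 : θ < 1)
    (hθ : θ ≤ (1 - (1 - (p * d) ^ (α : ℝ)) / ((1 - 1 / Real.exp 1) * (1 + ε)))
            ^ (1 / (1 + 1 / Real.logb d p))) :
    1 - (p * d) ^ (Real.logb p θ)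
      ≤ (1 - (p * d) ^ (α : ℝ)) / ((1 - 1 / Real.exp 1) * (1 + ε)) := by
  have hd0 : 0 < d := by linarith
  have hlp : Real.log p < 0 := Real.log_neg hp0 hp1
  have hld : 0 < Real.log d := Real.log_pos hd
  have hlpd : 0 < Real.log p + Real.log d := by
    rw [← Real.log_mul hp0.ne' hd0.ne']
    exact Real.log_pos hpd
  have hceq : 1 + 1 / Real.logb d p = (Real.log p + Real.log d) / Real.log p := by
    have := hlp.ne
    unfold Real.logb
    field_simp
  have hc : 1 + 1 / Real.logb d p < 0 := by
    rw [hceq]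
    exact div_neg_of_pos_of_neg hlpd hlp
  have hpow : (p * d) ^ (Real.logb p θ) = θ ^ (1 + 1 / Real.logb d p) := by
    rw [hceq, Real.rpow_def_of_pos (by positivity), Real.rpow_def_of_pos hθ0,
      Real.log_mul hp0.ne' hd0.ne']
    unfold Real.logb
    congr 1
    ring
  have he : 0 < 1 - 1 / Real.exp 1 := by
    have h1 : (1 : ℝ) < Real.exp 1 := Real.one_lt_exp_iff.mpr one_pos
    have : 1 / Real.exp 1 < 1 := (div_lt_one (Real.exp_pos 1)).mpr h1
    linarith
  have hq : (1 - (p * d) ^ (α : ℝ)) / ((1 - 1 / Real.exp 1) * (1 + ε)) ≤ 0 := by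
    apply div_nonpos_of_nonpos_of_nonneg
    · have := Real.one_le_rpow hpd.le (Nat.cast_nonneg α)
      linarith
    · have : 0 < 1 + ε := by linarith
      positivity
  rw [hpow]
  generalize 1 + 1 / Real.logb d p = c at *
  generalize (1 - (p * d) ^ (α : ℝ)) / ((1 - 1 / Real.exp 1) * (1 + ε)) = q at *
  have hX : 0 < 1 - q := by linarith
  have h := Real.rpow_le_rpow_of_nonpos hθ0 hθ hc.le
  rw [← Real.rpow_mul hX.le, one_div, inv_mul_cancel₀ hc.ne, Real.rpow_one] at h
  linarith
end

section
/- Correctness of the set-cover reduction instance: let I and U be finite types and F : I → Finset U a collection of subsets of the ground set U. On the vertex type V = I ⊕ U define w ≡ 1 and define p by p (inl i) (inr e) = 1 if e ∈ F i and p u v = 0 for all other pairs. Then for every finite set J of indices in I, taking the seed set S = image of J under inl, the influence value satisfies σ(S) = |J| + |⋃_{j ∈ J} F j| (where the union is the Finset biUnion of F over J). -/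
open Finset

/-- Correctness of the set-cover reduction instance: in the bipartite WIC instance
with unit weights and edges of probability 1 from the subset-node of F i to the
element-nodes of F i, the influence value of the seed set consisting of the
subset-nodes indexed by J equals |J| + |⋃_{j ∈ J} F j|. -/
theorem setcover_reduction {I U : Type*} [Fintype I] [Fintype U]
    [DecidableEq I] [DecidableEq U]
    (F : I → Finset U)
    (w : I ⊕ U → ℝ) (hw : ∀ v, w v = 1)
    (p : I ⊕ U → I ⊕ U → ℝ)
    (hpF : ∀ i e, p (Sum.inl i) (Sum.inr e) = if e ∈ F i then 1 else 0)
    (hpII : ∀ i i', p (Sum.inl i) (Sum.inl i') = 0)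
    (hpU : ∀ e v, p (Sum.inr e) v = 0)
    (σ : Finset (I ⊕ U) → ℝ)
    (hσ : ∀ S : Finset (I ⊕ U),
      σ S = (∑ u ∈ S, w u) + ∑ v : I ⊕ U, w v * (1 - ∏ u ∈ S, (1 - p u v)))
    (J : Finset I) :
    σ (J.image Sum.inl) = (J.card : ℝ) + ((J.biUnion F).card : ℝ) := by
  have hinj : Function.Injective (Sum.inl : I → I ⊕ U) := Sum.inl_injective
  have key : ∀ e : U, (1 : ℝ) - ∏ j ∈ J, (1 - (if e ∈ F j then (1 : ℝ) else 0))
      = if e ∈ J.biUnion F then 1 else 0 := by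
    intro e
    by_cases h : e ∈ J.biUnion F
    · rw [if_pos h]
      obtain ⟨j, hj, he⟩ := Finset.mem_biUnion.1 h
      rw [Finset.prod_eq_zero hj (by simp [he])]
      simp
    · rw [if_neg h]
      have : ∏ j ∈ J, (1 - (if e ∈ F j then (1 : ℝ) else 0)) = 1 := by
        apply Finset.prod_eq_one
        intro j hj
        have : e ∉ F j := fun he => h (Finset.mem_biUnion.2 ⟨j, hj, he⟩)
        simp [this]
      rw [this, sub_self]
  rw [hσ, Finset.sum_image (fun a _ b _ h => hinj h), Fintype.sum_sum_type]
  simp only [Finset.prod_image (fun a _ b _ h => hinj h), hw, hpF, hpII, key, one_mul]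
  rw [Finset.sum_boole]
  simp only [Finset.filter_univ_mem]
  simp
end
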